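/- arXiv:2502.06290 — 2 statements merged into one kernel-verified Lean document; each statement's English description precedes it below -/
import Mathlib

section
/- Let n ≥ 2 and let f ∈ ℂ[x₀,…,xₙ] be homogeneous of degree d such that V = V(f) ⊆ ℙⁿ has only isolated singularities, and assume no singular point of V lies on the hyperplane x₀ = 0. Set g(y₁,…,yₙ) = f(1,y₁,…,yₙ) and gⱼ = ∂g/∂yⱼ. Then the quotient ℂ[y₁,…,yₙ]/(gⁿ, g₁,…,gₙ) is a finite-dimensional ℂ-vector space and dim_ℂ ℂ[y₁,…,yₙ]/(gⁿ, g₁,…,gₙ) = Σ_p dim_ℂ ( ℂ[y₁,…,yₙ]/(g₁,…,gₙ) localized at the maximal ideal 𝔪_p ), where the sum runs over the finitely many points p ∈ ℂⁿ with g(p) = 0 and g₁(p) = ⋯ = gₙ(p) = 0; that is, the dimension equals the total Milnor number μ(V) = Σ_{p ∈ Sing(V)} μ_p(V). -/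
open MvPolynomial

noncomputable section

/-- Dehomogenization with respect to `x₀`: substitute `x₀ = 1`, `xᵢ = yᵢ`. -/
def deh (n : ℕ) : MvPolynomial (Fin (n + 1)) ℂ →ₐ[ℂ] MvPolynomial (Fin n) ℂ :=
  aeval (fun i => Fin.cases 1 (fun j => X j) i)

/-- The multiplicative set of polynomials not vanishing at the point `p`; localizing at it is
localizing at the maximal ideal `𝔪_p`. -/
def nv (n : ℕ) (p : Fin n → ℂ) : Submonoid (MvPolynomial (Fin n) ℂ) where
  carrier := {u | eval p u ≠ 0}
  mul_mem' := by
    intro a b ha hb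
    simp only [Set.mem_setOf_eq, map_mul] at *
    exact mul_ne_zero ha hb
  one_mem' := by simp

/-- The `ℂ`-dimension of the localization of `ℂ[y₁,…,yₙ]/J` at the maximal ideal `𝔪_p`,
computed as the localization of the polynomial ring at `𝔪_p` modulo the extension of `J`. -/
def locdim (n : ℕ) (J : Ideal (MvPolynomial (Fin n) ℂ)) (p : Fin n → ℂ) : ℕ :=
  Module.finrank ℂ
    (Localization (nv n p) ⧸
      J.map (algebraMap (MvPolynomial (Fin n) ℂ) (Localization (nv n p))))


theorem arc_false {κ : Type*} [Field κ] [Algebra ℂ κ] {n : ℕ} (g : MvPolynomial (Fin n) ℂ)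
    (Y : Fin n → Polynomial κ) (v : ℕ) (hv : 1 ≤ v)
    (h1 : Polynomial.X ^ v ∣ aeval Y g) (h2 : ¬ Polynomial.X ^ (v+1) ∣ aeval Y g)
    (h3 : ∀ j, Polynomial.X ^ v ∣ aeval Y (pderiv j g)) : False := by
  have : CharZero κ := charZero_of_injective_algebraMap (algebraMap ℂ κ).injective
  have key : ∀ q : MvPolynomial (Fin n) ℂ, Polynomial.derivative (aeval Y q) =
      ∑ j, aeval Y (pderiv j q) * Polynomial.derivative (Y j) := by
    intro q
    induction q using MvPolynomial.induction_on with
    | C a => 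
      simp [MvPolynomial.algHom_C, Polynomial.algebraMap_apply]
    | add p q hp hq => simp [hp, hq, add_mul, Finset.sum_add_distrib]
    | mul_X p i hp =>
      have e : ∀ j, aeval Y (pderiv j (p * X i)) * Polynomial.derivative (Y j) =
          aeval Y (pderiv j p) * Polynomial.derivative (Y j) * Y i +
          (if i = j then aeval Y p * Polynomial.derivative (Y i) else 0) := by
        intro j
        rw [pderiv_mul, map_add, map_mul, map_mul, aeval_X]
        by_cases hij : i = j
        · subst hij
          rw [pderiv_X_self, map_one, if_pos rfl]; ring
        · rw [pderiv_X_of_ne hij, map_zero, if_neg hij]; ring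
      rw [Finset.sum_congr rfl fun j _ => e j, Finset.sum_add_distrib, ← Finset.sum_mul, ← hp,
        Finset.sum_ite_eq, if_pos (Finset.mem_univ _), map_mul, aeval_X, Polynomial.derivative_mul]
  have hd : Polynomial.X ^ v ∣ Polynomial.derivative (aeval Y g) := by
    rw [key]; exact Finset.dvd_sum fun j _ => (h3 j).mul_right _
  apply h2
  rw [Polynomial.X_pow_dvd_iff] at *
  intro d hdv
  rcases Nat.lt_succ_iff_lt_or_eq.mp hdv with h | h
  · exact h1 d h
  · subst h
    have := hd (d-1) (by omega)
    rw [Polynomial.coeff_derivative, Nat.sub_add_cancel hv] at this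
    rcases mul_eq_zero.mp this with h | h
    · exact h
    · exfalso
      have : ((d - 1 : ℕ) : κ) + 1 = (d : κ) := by exact_mod_cast Nat.sub_add_cancel hv
      rw [this] at h
      have := Nat.cast_eq_zero.mp h
      omega

theorem dvr_false {V : Type*} [CommRing V] [IsDomain V] [IsDiscreteValuationRing V] [Algebra ℂ V]
    [Algebra.EssFiniteType ℂ V] {n : ℕ} (g : MvPolynomial (Fin n) ℂ)
    (φ : MvPolynomial (Fin n) ℂ →ₐ[ℂ] V) (h0 : φ g ≠ 0) (hu : ¬ IsUnit (φ g))
    (hd : ∀ j, φ g ∣ φ (pderiv j g)) : False := by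
  obtain ⟨ϖ, hϖ⟩ := IsDiscreteValuationRing.exists_irreducible V
  obtain ⟨v, u, hvu⟩ := IsDiscreteValuationRing.eq_unit_mul_pow_irreducible h0 hϖ
  have hv : 1 ≤ v := by
    by_contra h
    have : v = 0 := by omega
    subst this
    apply hu
    rw [hvu]; simp
  have hmax : IsLocalRing.maximalIdeal V = Ideal.span {ϖ} := hϖ.maximalIdeal_eq
  let I : Ideal V := Ideal.span {ϖ ^ (v + 1)}
  have hI : I ≤ IsLocalRing.maximalIdeal V := by
    rw [hmax, Ideal.span_singleton_le_span_singleton]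
    exact dvd_pow_self _ (by omega)
  let κ := IsLocalRing.ResidueField V
  have : Algebra.EssFiniteType ℂ κ := Algebra.EssFiniteType.comp ℂ V κ
  have : Algebra.FormallySmooth ℂ κ := inferInstance
  let r : (V ⧸ I) →ₐ[ℂ] κ := Ideal.Quotient.liftₐ I (IsScalarTower.toAlgHom ℂ V κ) (by
    intro a ha
    exact (IsLocalRing.residue_eq_zero_iff a).mpr (hI ha))
  have hr : ∀ a, r (Ideal.Quotient.mk I a) = IsLocalRing.residue V a := fun a => rfl
  have hrs : Function.Surjective r := by
    intro x
    obtain ⟨a, rfl⟩ := IsLocalRing.residue_surjective x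
    exact ⟨Ideal.Quotient.mk I a, hr a⟩
  have hker : RingHom.ker r = Ideal.span {Ideal.Quotient.mk I ϖ} := by
    ext x
    obtain ⟨a, rfl⟩ := Ideal.Quotient.mk_surjective x
    rw [RingHom.mem_ker, hr, IsLocalRing.residue_eq_zero_iff, hmax]
    constructor
    · intro h
      have := Ideal.mem_map_of_mem (Ideal.Quotient.mk I) h
      rwa [Ideal.map_span, Set.image_singleton] at this
    · intro h
      rw [Ideal.mem_span_singleton] at h
      obtain ⟨y, hy⟩ := h
      obtain ⟨b, rfl⟩ := Ideal.Quotient.mk_surjective y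
      rw [← map_mul, Ideal.Quotient.mk_eq_mk_iff_sub_mem] at hy
      have h2 := hI hy
      rw [hmax] at h2
      have h3 := Ideal.add_mem _ h2 (Ideal.mul_mem_right b _ (Ideal.mem_span_singleton_self ϖ))
      simpa using h3
  have hnil : IsNilpotent (RingHom.ker r) := by
    refine ⟨v + 1, ?_⟩
    rw [hker, Ideal.span_singleton_pow, ← map_pow, Ideal.Quotient.eq_zero_iff_mem.mpr
      (Ideal.mem_span_singleton_self _)]
    simp
  let σ : κ →ₐ[ℂ] (V ⧸ I) :=
    Algebra.FormallySmooth.liftOfSurjective (AlgHom.id ℂ κ) r hrs hnil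
  have hσ : ∀ x, r (σ x) = x := fun x =>
    Algebra.FormallySmooth.liftOfSurjective_apply (AlgHom.id ℂ κ) r hrs hnil x
  let Ψ : Polynomial κ →+* (V ⧸ I) := Polynomial.eval₂RingHom σ.toRingHom (Ideal.Quotient.mk I ϖ)
  have hΨX : Ψ Polynomial.X = Ideal.Quotient.mk I ϖ := Polynomial.eval₂_X _ _
  have hΨC : ∀ c, Ψ (Polynomial.C c) = σ c := fun c => Polynomial.eval₂_C _ _
  have hstep : ∀ k : ℕ, ∀ a : V ⧸ I, ∃ P : Polynomial κ, ∃ b, a = Ψ P + Ideal.Quotient.mk I ϖ ^ k * b := by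
    intro k
    induction k with
    | zero => intro a; exact ⟨0, a, by simp⟩
    | succ k ih =>
      intro a
      obtain ⟨P, b, hb⟩ := ih a
      have hb2 : b - σ (r b) ∈ RingHom.ker r := by
        rw [RingHom.mem_ker, map_sub, hσ, sub_self]
      rw [hker, Ideal.mem_span_singleton] at hb2
      obtain ⟨c, hc⟩ := hb2
      refine ⟨P + Polynomial.X ^ k * Polynomial.C (r b), c, ?_⟩
      rw [hb, map_add, map_mul, map_pow, hΨX, hΨC, pow_succ]
      linear_combination (Ideal.Quotient.mk I ϖ) ^ k * hc
  have hϖ0 : Ideal.Quotient.mk I ϖ ^ (v + 1) = 0 := by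
    rw [← map_pow]; exact Ideal.Quotient.eq_zero_iff_mem.mpr (Ideal.mem_span_singleton_self _)
  have hsurj : ∀ a : V ⧸ I, ∃ P : Polynomial κ, Ψ P = a := by
    intro a
    obtain ⟨P, b, hb⟩ := hstep (v + 1) a
    exact ⟨P, by rw [hb, hϖ0]; simp⟩
  have hdiv : ∀ (P : Polynomial κ) (b : V) (k : ℕ), k ≤ v + 1 → Ψ P = Ideal.Quotient.mk I (ϖ ^ k * b) →
      Polynomial.X ^ k ∣ P := by
    intro P b k
    induction k generalizing b with
    | zero => intro _ _; simp
    | succ k ih =>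
      intro hk hP
      obtain ⟨P', rfl⟩ := ih (ϖ * b) (by omega) (by rw [hP]; congr 1; ring)
      obtain ⟨a, ha⟩ := Ideal.Quotient.mk_surjective (Ψ P')
      rw [map_mul, map_pow, hΨX, ← ha, ← map_pow, ← map_mul, Ideal.Quotient.mk_eq_mk_iff_sub_mem,
        Ideal.mem_span_singleton] at hP
      obtain ⟨e, he⟩ := hP
      have hϖa : ϖ ∣ a := by
        have : ϖ ^ k * a = ϖ ^ k * (ϖ * (b + ϖ ^ (v - k) * e)) := by
          have h5 : ϖ ^ (v + 1) = ϖ ^ k * (ϖ * ϖ ^ (v - k)) := by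
            rw [← pow_succ', ← pow_add]; congr 1; omega
          rw [h5] at he
          linear_combination he
        exact ⟨_, mul_left_cancel₀ (pow_ne_zero k hϖ.ne_zero) this⟩
      have hra : r (Ψ P') = 0 := by
        rw [← ha, hr, IsLocalRing.residue_eq_zero_iff, hmax, Ideal.mem_span_singleton]; exact hϖa
      have hc0 : P'.coeff 0 = 0 := by
        rw [← Polynomial.divX_mul_X_add P', map_add, map_add, hΨC, hσ, map_mul, map_mul, hΨX, hr,
          (IsLocalRing.residue_eq_zero_iff ϖ).mpr (by rw [hmax]; exact Ideal.mem_span_singleton_self _),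
          mul_zero, zero_add] at hra
        exact hra
      rw [pow_succ]
      exact mul_dvd_mul_left _ (Polynomial.X_dvd_iff.mpr hc0)
  choose Y hY using fun j => hsurj (Ideal.Quotient.mk I (φ (X j)))
  have hcomp : ∀ q : MvPolynomial (Fin n) ℂ, Ψ (aeval Y q) = Ideal.Quotient.mk I (φ q) := by
    intro q
    induction q using MvPolynomial.induction_on with
    | C a =>
      rw [MvPolynomial.algHom_C, MvPolynomial.algHom_C, Polynomial.algebraMap_apply, hΨC]
      exact σ.commutes a
    | add p q hp hq => rw [map_add, map_add, map_add, map_add, hp, hq]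
    | mul_X p i hp => rw [map_mul, map_mul, map_mul, map_mul, hp, aeval_X, hY]
  refine arc_false g Y v hv ?_ ?_ ?_
  · exact hdiv _ u v (by omega) (by rw [hcomp, hvu, mul_comm])
  · rintro ⟨P, hP⟩
    have := hcomp g
    rw [hP, map_mul, map_pow, hΨX, hϖ0, zero_mul, eq_comm, Ideal.Quotient.eq_zero_iff_mem,
      Ideal.mem_span_singleton, hvu, pow_succ] at this
    obtain ⟨c, hc⟩ := this
    apply hϖ.not_isUnit
    have h6 : (u : V) = ϖ * c := by
      apply mul_left_cancel₀ (pow_ne_zero v hϖ.ne_zero)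
      linear_combination hc
    exact isUnit_of_mul_isUnit_left (h6 ▸ u.isUnit)
  · intro j
    obtain ⟨c, hc⟩ := hd j
    refine hdiv _ (u * c) v (by omega) ?_
    rw [hcomp, hc, hvu]; congr 1; ring

theorem exists_dvr {B : Type*} [CommRing B] [IsDomain B] [IsNoetherianRing B] [IsIntegrallyClosed B]
    (b : B) (hb0 : b ≠ 0) (hb : ¬ IsUnit b) : ∃ (Q : Ideal B) (_ : Q.IsPrime), b ∈ Q ∧
      IsDiscreteValuationRing (Localization.AtPrime Q) := by
  have hne : Ideal.span {b} ≠ ⊤ := by rwa [Ne, Ideal.span_singleton_eq_top]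
  obtain ⟨Q, hQ⟩ := Ideal.nonempty_minimalPrimes hne
  have hQp : Q.IsPrime := hQ.1.1
  have hbQ : b ∈ Q := hQ.1.2 (Ideal.mem_span_singleton_self b)
  refine ⟨Q, hQp, hbQ, ?_⟩
  have hh := Ideal.height_le_one_of_isPrincipal_of_mem_minimalPrimes (Ideal.span {b}) Q hQ
  have hdim : ringKrullDim (Localization.AtPrime Q) ≤ 1 := by
    rw [IsLocalization.AtPrime.ringKrullDim_eq_height Q]
    exact_mod_cast hh
  have : Ring.KrullDimLE 1 (Localization.AtPrime Q) := by
    rw [Ring.krullDimLE_iff]; exact_mod_cast hdim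
  have hIC : IsIntegrallyClosed (Localization.AtPrime Q) :=
    isIntegrallyClosed_of_isLocalization (Localization.AtPrime Q) Q.primeCompl Q.primeCompl_le_nonZeroDivisors
  have hmem : algebraMap B (Localization.AtPrime Q) b ∈ IsLocalRing.maximalIdeal (Localization.AtPrime Q) :=
    (IsLocalization.AtPrime.to_map_mem_maximal_iff _ Q b).mpr hbQ
  have hnz : algebraMap B (Localization.AtPrime Q) b ≠ 0 := by
    rw [Ne, IsLocalization.to_map_eq_zero_iff (M := Q.primeCompl) _ Q.primeCompl_le_nonZeroDivisors]
    exact hb0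
  have hnf : ¬ IsField (Localization.AtPrime Q) := by
    intro h
    rw [IsLocalRing.isField_iff_maximalIdeal_eq] at h
    rw [h] at hmem
    exact hnz hmem
  have hm0 : IsLocalRing.maximalIdeal (Localization.AtPrime Q) ≠ ⊥ :=
    fun h => hnf (IsLocalRing.isField_iff_maximalIdeal_eq.mpr h)
  have htf := (IsDiscreteValuationRing.TFAE (Localization.AtPrime Q) hnf).out 0 3
  refine htf.mpr ⟨hIC, _, ⟨hm0, inferInstance⟩, ?_⟩
  rintro P ⟨hP, hP'⟩
  exact IsLocalRing.eq_maximalIdeal (Ideal.isMaximal_of_isPrime_of_ne_bot P hP)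

theorem unit_lemma {S : Type} [CommRing S] [IsDomain S] [Algebra ℂ S] [Algebra.FiniteType ℂ S]
    {n : ℕ} (g : MvPolynomial (Fin n) ℂ)
    (φ : MvPolynomial (Fin n) ℂ →ₐ[ℂ] S) (h0 : φ g ≠ 0)
    (hd : ∀ j, φ g ∣ φ (pderiv j g)) : IsUnit (φ g) := by
  by_contra hu
  obtain ⟨s, θ, hinj, hfin⟩ := exists_finite_inj_algHom_of_fg ℂ S
  let A := MvPolynomial (Fin s) ℂ
  let L := FractionRing S
  algebraize [θ.toRingHom]
  have : IsScalarTower ℂ A S := IsScalarTower.of_algebraMap_eq' θ.comp_algebraMap.symm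
  have : FaithfulSMul A S := (faithfulSMul_iff_algebraMap_injective A S).mpr hinj
  have : Module.Finite A S := hfin
  have : Algebra.IsIntegral A S := inferInstance
  let K := FractionRing A
  have hAL : Function.Injective (algebraMap A L) := by
    rw [IsScalarTower.algebraMap_eq A S L]
    exact (IsFractionRing.injective S L).comp hinj
  have : FaithfulSMul A L := (faithfulSMul_iff_algebraMap_injective A L).mpr hAL
  let : Algebra K L := FractionRing.liftAlgebra A L
  have : IsScalarTower A K L := FractionRing.isScalarTower_liftAlgebra A L
  have : FiniteDimensional K L := inferInstance
  have : CharZero K := charZero_of_injective_algebraMap (algebraMap ℂ K).injective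
  have : Algebra.IsSeparable K L := inferInstance
  let B := integralClosure A L
  have : Module.Finite A B := IsIntegralClosure.finite A K L B
  have : IsNoetherianRing B := IsIntegralClosure.isNoetherianRing A K L B
  have : IsIntegrallyClosed B := integralClosure.isIntegrallyClosedOfFiniteExtension K
  let ι : S →ₐ[A] B := (IsScalarTower.toAlgHom A S L).codRestrict B (fun x => (Algebra.IsIntegral.isIntegral (R := A) x).map (IsScalarTower.toAlgHom A S L))
  have hιinj : Function.Injective ι := by
    intro x y h
    exact IsFractionRing.injective S L (congrArg Subtype.val h)
  have hιint : ι.toRingHom.IsIntegral := by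
    intro b
    have hb : IsIntegral A b := Algebra.IsIntegral.isIntegral b
    obtain ⟨P, hP, hP0⟩ := hb
    refine ⟨P.map (algebraMap A S), hP.map _, ?_⟩
    rw [Polynomial.eval₂_map]
    have : ι.toRingHom.comp (algebraMap A S) = algebraMap A B := ι.comp_algebraMap
    rw [this]; exact hP0
  have := hιint.isLocalHom hιinj
  have hgB : ¬ IsUnit (ι.toRingHom (φ g)) := fun h => hu (isUnit_of_map_unit ι.toRingHom _ h)
  have hgB0 : ι.toRingHom (φ g) ≠ 0 := fun h => h0 (hιinj (by rw [map_zero]; exact h))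
  obtain ⟨Q, hQ, hgQ, hdvr⟩ := exists_dvr _ hgB0 hgB
  let V := Localization.AtPrime Q
  have hft : Algebra.FiniteType ℂ B := Algebra.FiniteType.trans (S := A) inferInstance inferInstance
  have : Algebra.EssFiniteType ℂ V := Algebra.EssFiniteType.comp ℂ B V
  let ψ : MvPolynomial (Fin n) ℂ →ₐ[ℂ] V :=
    (IsScalarTower.toAlgHom ℂ B V).comp ((ι.restrictScalars ℂ).comp φ)
  have hψ : ∀ q, ψ q = algebraMap B V (ι.toRingHom (φ q)) := fun q => rfl
  refine dvr_false (V := V) g ψ ?_ ?_ ?_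
  · rw [hψ, Ne, IsLocalization.to_map_eq_zero_iff (M := Q.primeCompl) _ Q.primeCompl_le_nonZeroDivisors]
    exact hgB0
  · rw [hψ, IsLocalization.AtPrime.isUnit_to_map_iff V Q]
    exact fun h => h hgQ
  · intro j
    rw [hψ, hψ]
    exact map_dvd _ (map_dvd _ (hd j))

theorem sup_span_pow_le {R : Type*} [CommRing R] (J : Ideal R) (g : R) (k : ℕ) :
    (J ⊔ Ideal.span {g}) ^ (k + 1) ≤ J * (J ⊔ Ideal.span {g}) ^ k ⊔ Ideal.span {g ^ (k + 1)} := by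
  induction k with
  | zero => simp
  | succ k ih =>
    conv_lhs => rw [pow_succ', Ideal.sup_mul]
    refine sup_le le_sup_left ?_
    refine (Ideal.mul_mono_right ih).trans ?_
    rw [Ideal.mul_sup, Ideal.span_singleton_mul_span_singleton, ← pow_succ']
    refine sup_le_sup ?_ le_rfl
    rw [← mul_assoc, mul_comm (Ideal.span {g}) J, mul_assoc]
    refine Ideal.mul_mono_right ?_
    rw [pow_succ' _ k]
    exact Ideal.mul_mono_left le_sup_right

theorem integral_data {n : ℕ} (g : MvPolynomial (Fin n) ℂ) (hg : g ≠ 0)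
    (J : Ideal (MvPolynomial (Fin n) ℂ)) (hJ : J = Ideal.span (Set.range fun j => pderiv j g)) :
    ∃ (a : MvPolynomial (Fin n) ℂ) (k : ℕ), ∀ x ∈ (J ⊔ Ideal.span {g}) ^ k,
      (1 - a * g) * g * x ∈ J * (J ⊔ Ideal.span {g}) ^ k := by
  let R := MvPolynomial (Fin n) ℂ
  let K := FractionRing R
  let al := algebraMap R K
  have hal : Function.Injective al := IsFractionRing.injective R K
  have hg' : al g ≠ 0 := fun h => hg (hal (by rw [h, map_zero]))
  let w : Fin n → K := fun j => al (pderiv j g) / al g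
  let S := Algebra.adjoin R (Set.range w)
  have hft : Algebra.FiniteType R S := by
    rw [← Subalgebra.fg_iff_finiteType]
    exact Subalgebra.fg_def.mpr ⟨_, Set.finite_range w, rfl⟩
  have : Algebra.FiniteType ℂ S := Algebra.FiniteType.trans (S := R) inferInstance hft
  let φ : R →ₐ[ℂ] S := IsScalarTower.toAlgHom ℂ R S
  have hφ : ∀ x, ((φ x : S) : K) = al x := fun x => rfl
  have hunit : IsUnit (φ g) := by
    refine unit_lemma g φ ?_ ?_
    · intro h
      apply hg'
      rw [← hφ, h]; rfl
    · intro j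
      refine ⟨⟨w j, Algebra.subset_adjoin ⟨j, rfl⟩⟩, ?_⟩
      apply Subtype.ext
      rw [MulMemClass.coe_mul, hφ, hφ]
      exact (mul_div_cancel₀ _ hg').symm
  obtain ⟨σ, hσ⟩ := hunit.exists_right_inv
  have hσ' : al g * (σ : K) = 1 := by
    have := congrArg Subtype.val hσ
    rwa [MulMemClass.coe_mul, hφ] at this
  set I := J ⊔ Ideal.span {g} with hI
  have hgI : g ∈ I := Ideal.mem_sup_right (Ideal.mem_span_singleton_self g)
  have claim : ∀ τ ∈ S, ∃ N : ℕ, ∃ b ∈ I ^ N, τ * al g ^ N = al b := by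
    intro τ hτ
    induction hτ using Algebra.adjoin_induction with
    | mem x hx =>
      obtain ⟨j, rfl⟩ := hx
      refine ⟨1, pderiv j g, ?_, ?_⟩
      · rw [pow_one]
        apply Ideal.mem_sup_left
        rw [hJ]; exact Ideal.subset_span ⟨j, rfl⟩
      · rw [pow_one]; exact div_mul_cancel₀ _ hg'
    | algebraMap r => exact ⟨0, r, by simp, by simp [al]⟩
    | add x y _ _ hx hy =>
      obtain ⟨N, b, hb, e⟩ := hx
      obtain ⟨M, c, hc, e'⟩ := hy
      refine ⟨N + M, b * g ^ M + g ^ N * c, ?_, ?_⟩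
      · rw [pow_add]
        exact Ideal.add_mem _ (Ideal.mul_mem_mul hb (Ideal.pow_mem_pow hgI M))
          (Ideal.mul_mem_mul (Ideal.pow_mem_pow hgI N) hc)
      · rw [map_add, map_mul, map_mul, map_pow, map_pow, ← e, ← e']; ring
    | mul x y _ _ hx hy =>
      obtain ⟨N, b, hb, e⟩ := hx
      obtain ⟨M, c, hc, e'⟩ := hy
      refine ⟨N + M, b * c, ?_, ?_⟩
      · rw [pow_add]
        exact Ideal.mul_mem_mul hb hc
      · rw [map_mul, ← e, ← e']; ring
  obtain ⟨k, b, hb, e⟩ := claim σ σ.2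
  have e2 : g ^ k = g * b := by
    apply hal
    rw [map_mul, ← e, map_pow, ← mul_assoc, hσ', one_mul]
  have e3 : g ^ (k + 1) = g * (b * g) := by rw [pow_succ, e2]; ring
  have hbg : b * g ∈ I ^ (k + 1) := by rw [pow_succ]; exact Ideal.mul_mem_mul hb hgI
  obtain ⟨y, hy, z, hz, hyz⟩ := Submodule.mem_sup.mp (sup_span_pow_le J g k hbg)
  obtain ⟨a, rfl⟩ := Ideal.mem_span_singleton'.mp hz
  have e4 : (1 - a * g) * g ^ (k + 1) ∈ J * I ^ k := by
    have : (1 - a * g) * g ^ (k + 1) = g * y := by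
      linear_combination e3 - g * hyz
    rw [this]
    exact Ideal.mul_mem_left _ _ hy
  refine ⟨a, k, fun x hx => ?_⟩
  have hxg : g * x ∈ I ^ (k + 1) := by rw [pow_succ']; exact Ideal.mul_mem_mul hgI hx
  obtain ⟨y, hy, z, hz, hyz⟩ := Submodule.mem_sup.mp (sup_span_pow_le J g k hxg)
  obtain ⟨c, rfl⟩ := Ideal.mem_span_singleton'.mp hz
  have : (1 - a * g) * g * x = (1 - a * g) * y + c * ((1 - a * g) * g ^ (k + 1)) := by
    linear_combination - (1 - a * g) * hyz
  rw [this]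
  exact Ideal.add_mem _ (Ideal.mul_mem_left _ _ hy) (Ideal.mul_mem_left _ _ e4)

theorem expand_card_pow {k : Type*} [Field k] [Fintype k] {m : ℕ} (e : ℕ)
    (f : MvPolynomial (Fin m) k) : expand (Fintype.card k ^ e) f = f ^ (Fintype.card k ^ e) := by
  obtain ⟨p, hp⟩ := CharP.exists k
  obtain ⟨r, hpp, hr⟩ := FiniteField.card k p
  have : Fact p.Prime := ⟨hpp⟩
  induction f using MvPolynomial.induction_on with
  | C a => rw [expand_C, ← C_pow, FiniteField.pow_card_pow]
  | add x y hx hy => rw [map_add, hx, hy, hr, ← pow_mul, add_pow_char_pow]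
  | mul_X x i hx => rw [map_mul, hx, expand_X, mul_pow]

theorem span_pow_le_frob {R : Type*} [CommRing R] {ι : Type*} [DecidableEq ι] (G : ι → R) (q : ℕ)
    (t : Finset ι) (ht : t.Nonempty) :
    (Ideal.span (G '' t)) ^ (t.card * q) ≤ Ideal.span ((fun i => G i ^ q) '' t) := by
  induction ht using Finset.Nonempty.cons_induction with
  | singleton a => simp [Ideal.span_singleton_pow]
  | cons a s h hs ih =>
    rw [Finset.card_cons, Finset.coe_cons, Set.image_insert_eq, Set.image_insert_eq,
      Ideal.span_insert, Ideal.span_insert, add_mul, add_comm, one_mul]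
    refine Ideal.sup_pow_add_le_pow_sup_pow.trans (sup_le_sup ?_ ih)
    rw [Ideal.span_singleton_pow]

/-- Cartier-type operator. -/
def cart {k : Type*} [Field k] {m : ℕ} (q : ℕ) (α : Fin m →₀ ℕ) :
    MvPolynomial (Fin m) k →ₗ[k] MvPolynomial (Fin m) k :=
  (basisMonomials (Fin m) k).constr k (fun β => open Classical in
    if ∀ i, β i % q = α i then monomial (β.mapRange (· / q) (Nat.zero_div q)) (1 : k) else 0)

theorem cart_monomial {k : Type*} [Field k] {m : ℕ} (q : ℕ) (α β : Fin m →₀ ℕ) (a : k) :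
    cart q α (monomial β a) = open Classical in
     if ∀ i, β i % q = α i then monomial (β.mapRange (· / q) (Nat.zero_div q)) a else 0 := by
  classical
  have h1 : monomial β a = a • (basisMonomials (Fin m) k β) := by
    rw [coe_basisMonomials, smul_monomial, smul_eq_mul, mul_one]
  rw [h1, map_smul, cart, Module.Basis.constr_basis]
  split_ifs
  · rw [smul_monomial, smul_eq_mul, mul_one]
  · simp

theorem cart_expand_mul {k : Type*} [Field k] {m : ℕ} (q : ℕ) (hq : 0 < q) (α : Fin m →₀ ℕ)
    (x b : MvPolynomial (Fin m) k) : cart q α (expand q x * b) = x * cart q α b := by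
  classical
  induction x using MvPolynomial.induction_on' with
  | add p r hp hr => rw [map_add, add_mul, map_add, hp, hr, add_mul]
  | monomial γ a =>
    induction b using MvPolynomial.induction_on' with
    | add p r hp hr => rw [mul_add, map_add, hp, hr, map_add, mul_add]
    | monomial β b =>
      rw [expand_monomial, monomial_mul, cart_monomial, cart_monomial]
      have h1 : (∀ i, (q • γ + β) i % q = α i) ↔ (∀ i, β i % q = α i) := by
        refine forall_congr' fun i => ?_
        simp
      simp only [h1]
      split_ifs
      · rw [monomial_mul]
        have h2 : Finsupp.mapRange (· / q) (Nat.zero_div q) (q • γ + β) =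
            γ + Finsupp.mapRange (· / q) (Nat.zero_div q) β := by
          ext i
          simp [Nat.mul_add_div hq]
        rw [h2]
      · simp

theorem charp_bs {k : Type*} [Field k] [Finite k] {m n : ℕ} (hn : 0 < n)
    (G : Fin n → MvPolynomial (Fin m) k) (h c : MvPolynomial (Fin m) k) (hc : c ≠ 0)
    (H : ∀ N, c * h ^ N ∈ (Ideal.span (Set.range G)) ^ N) : h ^ n ∈ Ideal.span (Set.range G) := by
  classical
  have := Fintype.ofFinite k
  obtain ⟨α, hα⟩ := MvPolynomial.ne_zero_iff.mp hc
  obtain ⟨e, he⟩ : ∃ e, c.totalDegree < Fintype.card k ^ e :=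
    pow_unbounded_of_one_lt _ Fintype.one_lt_card
  set q := Fintype.card k ^ e with hq
  have hq0 : 0 < q := by omega
  have hlt : ∀ β ∈ c.support, ∀ i, β i < q := by
    intro β hβ i
    refine lt_of_le_of_lt ?_ he
    exact (Finsupp.le_degree i β).trans (le_totalDegree hβ)
  have hcart : cart q α c = C (coeff α c) := by
    rw [c.as_sum, map_sum, Finset.sum_eq_single α]
    · rw [cart_monomial, if_pos, ← c.as_sum]
      · have h2 : Finsupp.mapRange (· / q) (Nat.zero_div q) α = 0 := by
          ext i
          simpa using Or.inr (hlt α (mem_support_iff.mpr hα) i)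
        rw [h2, C_apply]
      · intro i
        exact Nat.mod_eq_of_lt (hlt α (mem_support_iff.mpr hα) i)
    · intro β hβ hne
      rw [cart_monomial, if_neg]
      intro h'
      apply hne
      ext i
      rw [← h' i, Nat.mod_eq_of_lt (hlt β hβ i)]
    · intro h'
      exact absurd (mem_support_iff.mpr hα) h'
  have h1 := H (n * q)
  have h2 : c * h ^ (n * q) ∈ Ideal.span (Set.range fun i => expand q (G i)) := by
    have h3 := span_pow_le_frob G q Finset.univ (by rw [Finset.univ_nonempty_iff]; exact ⟨⟨0, hn⟩⟩)
    rw [Finset.coe_univ, Set.image_univ, Set.image_univ, Finset.card_univ, Fintype.card_fin] at h3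
    have h4 : (fun i => expand q (G i)) = fun i => G i ^ q := by
      ext1 i; exact expand_card_pow e _
    rw [h4]
    exact h3 h1
  rw [pow_mul, hq, ← expand_card_pow e, ← hq, mul_comm, Ideal.mem_span_range_iff_exists_fun] at h2
  obtain ⟨d, hd⟩ := h2
  have h5 := congrArg (cart q α) hd
  rw [cart_expand_mul q hq0, hcart, map_sum] at h5
  have h6 : h ^ n * C (coeff α c) ∈ Ideal.span (Set.range G) := by
    rw [← h5]
    refine Ideal.sum_mem _ fun i _ => ?_
    rw [mul_comm, cart_expand_mul q hq0]
    exact Ideal.mul_mem_right _ _ (Ideal.subset_span ⟨i, rfl⟩)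
  have h7 := Ideal.mul_mem_right (C (coeff α c)⁻¹) _ h6
  rwa [mul_assoc, ← C_mul, mul_inv_cancel₀ hα, C_1, mul_one] at h7

theorem jac_int : IsJacobsonRing ℤ := by
  rw [isJacobsonRing_iff_prime_eq]
  intro P hP
  by_cases h0 : P = ⊥
  · subst h0
    rw [eq_bot_iff]
    intro x hx
    rw [Ideal.mem_jacobson_bot] at hx
    by_contra hne
    have hne' : x ≠ 0 := hne
    have h1 := hx (3 * x)
    rw [Int.isUnit_iff] at h1
    have : 0 < x * x := mul_self_pos.mpr hne
    rcases h1 with h1 | h1 <;> nlinarith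
  · have := hP.isMaximal h0
    exact Ideal.jacobson_eq_self_of_isMaximal

theorem finite_residue {A : Type*} [CommRing A] [Algebra.FiniteType ℤ A] (m : Ideal A) [m.IsMaximal] :
    Finite (A ⧸ m) := by
  have := jac_int
  let := Ideal.Quotient.field m
  have hF : Module.Finite ℤ (A ⧸ m) := finite_of_finite_type_of_isJacobsonRing ℤ (A ⧸ m)
  obtain ⟨p, hp⟩ := CharP.exists (A ⧸ m)
  have hp0 : p ≠ 0 := by
    rintro rfl
    have : CharZero (A ⧸ m) := CharP.charP_to_charZero _
    have hinj : Function.Injective (algebraMap ℤ (A ⧸ m)) := by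
      intro a b h
      simpa using h
    have := isField_of_isIntegral_of_isField hinj (Field.toIsField (A ⧸ m))
    exact Int.not_isField this
  have hT : Module.IsTorsion ℤ (A ⧸ m) := by
    intro x
    refine ⟨⟨(p : ℤ), mem_nonZeroDivisors_of_ne_zero (by exact_mod_cast hp0)⟩, ?_⟩
    change ((p : ℤ) • x) = 0
    rw [zsmul_eq_mul]; simp
  exact Module.finite_of_fg_torsion _ hT

theorem bs_functional {m n r : ℕ} (hn : 0 < n) (G : Fin n → MvPolynomial (Fin m) ℂ)
    (h : MvPolynomial (Fin m) ℂ) (e : Fin r → MvPolynomial (Fin m) ℂ)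
    (b : Fin r → Fin n → Fin r → MvPolynomial (Fin m) ℂ) (i0 : Fin r) (he : e i0 ≠ 0)
    (hrel : ∀ i, h * e i = ∑ j, G j * ∑ l, b i j l * e l)
    (lam : MvPolynomial (Fin m) ℂ →ₗ[ℂ] ℂ) (hlJ : ∀ x ∈ Ideal.span (Set.range G), lam x = 0)
    (hfin : (Set.range fun β => lam (monomial β 1)).Finite) : lam (h ^ n) = 0 := by
  classical
  by_contra ht
  obtain ⟨β0, hβ0⟩ := MvPolynomial.ne_zero_iff.mp he
  let T : Set ℂ := (h.coeffs : Set ℂ) ∪ (⋃ j, ((G j).coeffs : Set ℂ)) ∪ (⋃ i, ((e i).coeffs : Set ℂ)) ∪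
    (⋃ i, ⋃ j, ⋃ l, ((b i j l).coeffs : Set ℂ)) ∪ (Set.range fun β => lam (monomial β 1)) ∪
    {(lam (h ^ n))⁻¹, (coeff β0 (e i0))⁻¹}
  have hT : T.Finite := by
    refine Set.Finite.union (Set.Finite.union (Set.Finite.union (Set.Finite.union (Set.Finite.union
      ?_ ?_) ?_) ?_) hfin) (Set.toFinite _)
    · exact Finset.finite_toSet _
    · exact Set.finite_iUnion fun _ => Finset.finite_toSet _
    · exact Set.finite_iUnion fun _ => Finset.finite_toSet _
    · exact Set.finite_iUnion fun _ => Set.finite_iUnion fun _ => Set.finite_iUnion fun _ =>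
        Finset.finite_toSet _
  let A := Algebra.adjoin ℤ T
  have hA : Algebra.FiniteType ℤ A := .adjoin_of_finite hT
  let α : A →+* ℂ := algebraMap A ℂ
  have hα : Function.Injective α := Subtype.val_injective
  have hTA : ∀ z ∈ T, ∃ a : A, α a = z := fun z hz => ⟨⟨z, Algebra.subset_adjoin hz⟩, rfl⟩
  have hlift : ∀ P : MvPolynomial (Fin m) ℂ, (P.coeffs : Set ℂ) ⊆ T → ∃ Q, MvPolynomial.map α Q = P := by
    intro P hP
    have : P ∈ Set.range (MvPolynomial.map α) := by
      rw [mem_range_map_iff_coeffs_subset]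
      intro z hz
      exact hTA z (hP hz)
    exact this
  obtain ⟨h', hh'⟩ := hlift h (fun z hz => by simp only [T, Set.mem_union]; tauto)
  have := fun j => hlift (G j) (fun z hz => by
    have : z ∈ (⋃ j, ((G j).coeffs : Set ℂ)) := Set.mem_iUnion.mpr ⟨j, hz⟩
    simp only [T, Set.mem_union]; tauto)
  choose G' hG' using this
  have := fun i => hlift (e i) (fun z hz => by
    have : z ∈ (⋃ j, ((e j).coeffs : Set ℂ)) := Set.mem_iUnion.mpr ⟨i, hz⟩
    simp only [T, Set.mem_union]; tauto)
  choose e' he' using this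
  have := fun i j l => hlift (b i j l) (fun z hz => by
    have : z ∈ (⋃ i, ⋃ j, ⋃ l, ((b i j l).coeffs : Set ℂ)) :=
      Set.mem_iUnion.mpr ⟨i, Set.mem_iUnion.mpr ⟨j, Set.mem_iUnion.mpr ⟨l, hz⟩⟩⟩
    simp only [T, Set.mem_union]; tauto)
  choose b' hb' using this
  have := fun β => hTA (lam (monomial β 1)) (by
    have : lam (monomial β 1) ∈ (Set.range fun β => lam (monomial β 1)) := ⟨β, rfl⟩
    simp only [T, Set.mem_union]; tauto)
  choose ell hell using this
  obtain ⟨ti, hti⟩ := hTA (lam (h ^ n))⁻¹ (by simp [T])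
  obtain ⟨ci, hci⟩ := hTA (coeff β0 (e i0))⁻¹ (by simp [T])
  have hrel' : ∀ i, h' * e' i = ∑ j, G' j * ∑ l, b' i j l * e' l := by
    intro i
    apply MvPolynomial.map_injective α hα
    simp only [map_mul, map_sum, hh', hG', he', hb']
    exact hrel i
  obtain ⟨M, hM⟩ := Ideal.exists_maximal A
  let := Ideal.Quotient.field M
  have : Finite (A ⧸ M) := finite_residue M
  let π : A →+* A ⧸ M := Ideal.Quotient.mk M
  have hπ : Function.Surjective π := Ideal.Quotient.mk_surjective
  let mp := MvPolynomial.map (σ := Fin m) π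
  have hrelk : ∀ i, mp h' * mp (e' i) = ∑ j, mp (G' j) * ∑ l, mp (b' i j l) * mp (e' l) := by
    intro i
    have := congrArg mp (hrel' i)
    simpa only [map_mul, map_sum] using this
  have hpow : ∀ N i, mp (e' i) * mp h' ^ N ∈ (Ideal.span (Set.range fun j => mp (G' j))) ^ N := by
    intro N
    induction N with
    | zero => intro i; simp
    | succ N ih =>
      intro i
      have : mp (e' i) * mp h' ^ (N + 1) =
          ∑ j, mp (G' j) * ∑ l, mp (b' i j l) * (mp (e' l) * mp h' ^ N) := by
        rw [pow_succ', ← mul_assoc, mul_comm (mp (e' i)), hrelk, Finset.sum_mul]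
        refine Finset.sum_congr rfl fun j _ => ?_
        rw [mul_assoc, Finset.sum_mul]
        congr 1
        exact Finset.sum_congr rfl fun l _ => by ring
      rw [this, pow_succ']
      refine Ideal.sum_mem _ fun j _ => Ideal.mul_mem_mul (Ideal.subset_span ⟨j, rfl⟩) ?_
      exact Ideal.sum_mem _ fun l _ => Ideal.mul_mem_left _ _ (ih l)
  have hne : mp (e' i0) ≠ 0 := by
    intro h0
    have h1 : π (coeff β0 (e' i0)) = 0 := by
      rw [← coeff_map]
      exact (congrArg (coeff β0) h0).trans (coeff_zero _)
    have h2 : coeff β0 (e' i0) * ci = 1 := by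
      apply hα
      rw [map_mul, ← coeff_map, he', hci, map_one, mul_inv_cancel₀ hβ0]
    have h3 := congrArg π h2
    rw [map_mul, h1, zero_mul, map_one] at h3
    exact zero_ne_one h3
  have hbs := charp_bs hn (fun j => mp (G' j)) (mp h') (mp (e' i0)) hne (fun N => hpow N i0)
  rw [Ideal.mem_span_range_iff_exists_fun] at hbs
  obtain ⟨d, hd⟩ := hbs
  choose D hD using fun j => MvPolynomial.map_surjective π hπ (d j)
  let P := h' ^ n - ∑ j, D j * G' j
  have hP0 : mp P = 0 := by
    simp only [P, map_sub, map_pow, map_sum, map_mul, mp, hD]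
    exact sub_eq_zero.mpr hd.symm
  have hPc : ∀ β, coeff β P ∈ M := by
    intro β
    rw [← Ideal.Quotient.eq_zero_iff_mem]
    change π (coeff β P) = 0
    rw [← coeff_map]
    exact (congrArg (coeff β) hP0).trans (coeff_zero _)
  have hlamP : ∀ Q : MvPolynomial (Fin m) A, lam (MvPolynomial.map α Q) =
      α (∑ β ∈ Q.support, coeff β Q * ell β) := by
    intro Q
    conv_lhs => rw [Q.as_sum]
    rw [map_sum, map_sum, map_sum]
    refine Finset.sum_congr rfl fun β _ => ?_
    rw [map_monomial, map_mul, hell, ← mul_one (α (coeff β Q)), ← smul_eq_mul, ← smul_monomial,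
      map_smul, smul_eq_mul, smul_eq_mul, mul_one]
  have hmem : (∑ β ∈ P.support, coeff β P * ell β) ∈ M :=
    Ideal.sum_mem _ fun β _ => Ideal.mul_mem_right _ _ (hPc β)
  have h8 : lam (MvPolynomial.map α P) = lam (h ^ n) := by
    simp only [P, map_sub, map_pow, map_sum, map_mul, hh', hG']
    rw [sub_eq_self]
    refine Finset.sum_eq_zero fun j _ => ?_
    exact hlJ _ (Ideal.mul_mem_left _ _ (Ideal.subset_span ⟨j, rfl⟩))
  have h9 : (∑ β ∈ P.support, coeff β P * ell β) * ti = 1 := by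
    apply hα
    rw [map_mul, ← hlamP, h8, hti, map_one, mul_inv_cancel₀ ht]
  have h10 := Ideal.mul_mem_right ti _ hmem
  rw [h9] at h10
  exact hM.ne_top ((Ideal.eq_top_iff_one _).mpr h10)

theorem bs_adic_zero {m n r : ℕ} (hn : 0 < n) (G : Fin n → MvPolynomial (Fin m) ℂ)
    (h : MvPolynomial (Fin m) ℂ) (e : Fin r → MvPolynomial (Fin m) ℂ)
    (b : Fin r → Fin n → Fin r → MvPolynomial (Fin m) ℂ) (i0 : Fin r) (he : e i0 ≠ 0)
    (hrel : ∀ i, h * e i = ∑ j, G j * ∑ l, b i j l * e l) (N : ℕ) :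
    h ^ n ∈ Ideal.span (Set.range G) ⊔
      (Ideal.span (Set.range (X : Fin m → MvPolynomial (Fin m) ℂ))) ^ N := by
  by_contra hc
  set I := Ideal.span (Set.range G) ⊔
      (Ideal.span (Set.range (X : Fin m → MvPolynomial (Fin m) ℂ))) ^ N with hI
  have hc' : h ^ n ∉ Submodule.restrictScalars ℂ I := hc
  obtain ⟨lam, h1, h2⟩ := Submodule.exists_le_ker_of_notMem hc'
  have h3 : ∀ x ∈ I, lam x = 0 := fun x hx => h2 hx
  apply h1
  refine bs_functional hn G h e b i0 he hrel lam (fun x hx => h3 x (Ideal.mem_sup_left hx)) ?_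
  have hfinN : {β : Fin m →₀ ℕ | β.degree ≤ N}.Finite := Finsupp.finite_of_degree_le N
  refine ((hfinN.image (fun β => lam (monomial β 1))).union (Set.finite_singleton 0)).subset ?_
  rintro _ ⟨β, rfl⟩
  by_cases hβ : β.degree ≤ N
  · exact Or.inl ⟨β, hβ, rfl⟩
  · right
    refine h3 _ (Ideal.mem_sup_right ?_)
    have hle : N ≤ ∑ i, β i := by
      rw [← Finsupp.degree_eq_sum]; omega
    apply Ideal.pow_le_pow_right hle
    rw [monomial_eq, C_1, one_mul, Finsupp.prod_fintype _ _ (by simp), ← Finset.prod_pow_eq_pow_sum]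
    exact Ideal.prod_mem_prod fun i _ => Ideal.pow_mem_pow (Ideal.subset_span (Set.mem_range_self i)) _

theorem bs_adic {m n r : ℕ} (hn : 0 < n) (G : Fin n → MvPolynomial (Fin m) ℂ)
    (h : MvPolynomial (Fin m) ℂ) (e : Fin r → MvPolynomial (Fin m) ℂ)
    (b : Fin r → Fin n → Fin r → MvPolynomial (Fin m) ℂ) (i0 : Fin r) (he : e i0 ≠ 0)
    (hrel : ∀ i, h * e i = ∑ j, G j * ∑ l, b i j l * e l) (p : Fin m → ℂ) (N : ℕ) :
    h ^ n ∈ Ideal.span (Set.range G) ⊔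
      (Ideal.span (Set.range fun i : Fin m => (X i - C (p i) : MvPolynomial (Fin m) ℂ))) ^ N := by
  let τ : MvPolynomial (Fin m) ℂ →ₐ[ℂ] MvPolynomial (Fin m) ℂ := aeval fun i => X i + C (p i)
  let σ : MvPolynomial (Fin m) ℂ →ₐ[ℂ] MvPolynomial (Fin m) ℂ := aeval fun i => X i - C (p i)
  have hστ : ∀ x, σ (τ x) = x := by
    intro x
    have : σ.comp τ = AlgHom.id ℂ _ := by
      ext i : 1
      simp [σ, τ, algHom_C]
    exact DFunLike.congr_fun this x
  have := bs_adic_zero hn (fun j => τ (G j)) (τ h) (fun i => τ (e i)) (fun i j l => τ (b i j l)) i0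
    (fun h0 => he (by rw [← hστ (e i0), h0, map_zero]))
    (fun i => by rw [← map_mul, hrel]; simp [map_sum]) N
  have h2 := Ideal.mem_map_of_mem σ this
  rw [← map_pow, hστ, Ideal.map_sup, Ideal.map_pow, Ideal.map_span, Ideal.map_span,
    ← Set.range_comp, ← Set.range_comp] at h2
  have e1 : (⇑σ ∘ fun j => τ (G j)) = G := by ext j : 1; simp [hστ]
  have e2 : (⇑σ ∘ X) = fun i : Fin m => (X i - C (p i) : MvPolynomial (Fin m) ℂ) := by
    ext j : 1; simp [σ]
  rw [e1, e2] at h2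
  exact h2

theorem krull_step {n : ℕ} (J : Ideal (MvPolynomial (Fin n) ℂ)) (p : Fin n → ℂ)
    (x : MvPolynomial (Fin n) ℂ)
    (hx : ∀ N : ℕ, x ∈ J ⊔ 
      (Ideal.span (Set.range fun i : Fin n => (X i - C (p i) : MvPolynomial (Fin n) ℂ))) ^ N) :
    ∃ u, eval p u = 1 ∧ u * x ∈ J := by
  set M := Ideal.span (Set.range fun i : Fin n => (X i - C (p i) : MvPolynomial (Fin n) ℂ))
  have hM : ∀ y ∈ M, eval p y = 0 := by
    intro y hy
    have : M ≤ RingHom.ker (eval p) := by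
      rw [Ideal.span_le]; rintro _ ⟨i, rfl⟩; simp [RingHom.mem_ker]
    exact this hy
  have key := (Ideal.mem_iInf_smul_pow_eq_bot_iff (I := M)
    (Submodule.Quotient.mk x : MvPolynomial (Fin n) ℂ ⧸ J)).mp (by
      rw [Submodule.mem_iInf]
      intro N
      obtain ⟨a, ha, c, hc, rfl⟩ := Submodule.mem_sup.mp (hx N)
      have : (Submodule.Quotient.mk (a + c) : MvPolynomial (Fin n) ℂ ⧸ J)
          = c • Submodule.Quotient.mk 1 := by
        rw [← Submodule.Quotient.mk_smul, Submodule.Quotient.eq]; simpa using ha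
      rw [this]
      exact Submodule.smul_mem_smul hc trivial)
  obtain ⟨⟨r, hr⟩, h⟩ := key
  refine ⟨1 - r, by simp [hM r hr], ?_⟩
  rw [← Submodule.Quotient.mk_smul, Submodule.Quotient.eq] at h
  have := J.neg_mem h
  convert this using 1
  simp only [smul_eq_mul]; ring

theorem bs_local {n : ℕ} (hn : 0 < n) (g : MvPolynomial (Fin n) ℂ) (p : Fin n → ℂ)
    (hp : eval p g = 0) :
    ∃ u, eval p u ≠ 0 ∧ u * g ^ n ∈ Ideal.span (Set.range fun j => pderiv j g) := by
  by_cases hg : g = 0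
  · exact ⟨1, by simp, by subst hg; simp [hn.ne']⟩
  set G : Fin n → MvPolynomial (Fin n) ℂ := fun j => pderiv j g
  set J := Ideal.span (Set.range G) with hJ
  obtain ⟨a, k, hk⟩ := integral_data g hg J rfl
  obtain ⟨r, e, hspan⟩ := Submodule.fg_iff_exists_fin_generating_family.mp
    (IsNoetherian.noetherian ((J ⊔ Ideal.span {g}) ^ k))
  have hgk : g ^ k ∈ (J ⊔ Ideal.span {g}) ^ k :=
    Ideal.pow_mem_pow (Ideal.mem_sup_right (Ideal.mem_span_singleton_self g)) k
  have hi0 : ∃ i0, e i0 ≠ 0 := by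
    by_contra! hc
    rw [← hspan] at hgk
    have : Submodule.span (MvPolynomial (Fin n) ℂ) (Set.range e) = ⊥ := by
      rw [Submodule.span_eq_bot]; rintro _ ⟨i, rfl⟩; exact hc i
    rw [this] at hgk
    exact pow_ne_zero k hg hgk
  obtain ⟨i0, hi0⟩ := hi0
  have hrel : ∀ i, ∃ b : Fin n → Fin r → MvPolynomial (Fin n) ℂ,
      ((1 - a * g) * g) * e i = ∑ j, G j * ∑ l, b j l * e l := by
    intro i
    have h1 := hk (e i) (by rw [← hspan]; exact Submodule.subset_span ⟨i, rfl⟩)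
    generalize (1 - a * g) * g * e i = y at h1
    refine Submodule.mul_induction_on h1 ?_ ?_
    · intro x hx m hm
      rw [hJ] at hx
      obtain ⟨c, rfl⟩ := (Ideal.mem_span_range_iff_exists_fun).mp hx
      rw [← hspan] at hm
      obtain ⟨d, rfl⟩ := (Submodule.mem_span_range_iff_exists_fun _).mp hm
      refine ⟨fun j l => c j * d l, ?_⟩
      rw [Finset.sum_mul]
      refine Finset.sum_congr rfl fun j _ => ?_
      simp only [smul_eq_mul, Finset.mul_sum]
      refine Finset.sum_congr rfl fun l _ => by ring
    · rintro x y ⟨b, rfl⟩ ⟨c, rfl⟩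
      refine ⟨fun j l => b j l + c j l, ?_⟩
      simp only [add_mul, Finset.sum_add_distrib, mul_add]
  choose b hb using hrel
  obtain ⟨u, hu1, hu2⟩ := krull_step J p _
    (fun N => bs_adic hn G ((1 - a * g) * g) e b i0 hi0 hb p N)
  refine ⟨u * (1 - a * g) ^ n, by simp [hu1, hp], ?_⟩
  rw [mul_pow, ← mul_assoc] at hu2
  exact hu2

theorem finite_quot {n : ℕ} (I : Ideal (MvPolynomial (Fin n) ℂ)) (Z : Finset (Fin n → ℂ))
    (hZ : ∀ p : Fin n → ℂ, (∀ x ∈ I, eval p x = 0) → p ∈ Z) :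
    Module.Finite ℂ (MvPolynomial (Fin n) ℂ ⧸ I) := by
  have hX : ∀ i, IsIntegral ℂ (Ideal.Quotient.mk I (X i)) := by
    intro i
    have hrad : (∏ p ∈ Z, (X i - C (p i)) : MvPolynomial (Fin n) ℂ) ∈ I.radical := by
      rw [← vanishingIdeal_zeroLocus_eq_radical (K := ℂ), mem_vanishingIdeal_iff]
      intro q hq
      have hqZ : q ∈ Z := hZ q (fun x hx => by simpa [aeval_eq_eval] using hq x hx)
      rw [map_prod]
      exact Finset.prod_eq_zero hqZ (by simp)
    obtain ⟨k, hk⟩ := hrad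
    refine ⟨(∏ p ∈ Z, (Polynomial.X - Polynomial.C (p i))) ^ k, ?_, ?_⟩
    · exact (Polynomial.monic_prod_of_monic _ _ fun p _ => Polynomial.monic_X_sub_C _).pow k
    · rw [← Ideal.Quotient.eq_zero_iff_mem] at hk
      rw [← hk]
      simp only [map_pow, map_prod, Polynomial.eval₂_pow, Polynomial.eval₂_finsetProd,
        Polynomial.eval₂_sub, Polynomial.eval₂_X, Polynomial.eval₂_C, map_sub]
      rfl
  have hIntegral : Algebra.IsIntegral ℂ (MvPolynomial (Fin n) ℂ ⧸ I) := by
    constructor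
    intro x
    obtain ⟨q, rfl⟩ := Ideal.Quotient.mk_surjective x
    induction q using MvPolynomial.induction_on with
    | C a => exact isIntegral_algebraMap (R := ℂ) (x := a)
    | add p q hp hq => rw [map_add]; exact hp.add hq
    | mul_X p i hp => rw [map_mul]; exact hp.mul (hX i)
  exact Algebra.IsIntegral.finite

def locq (n : ℕ) (I : Ideal (MvPolynomial (Fin n) ℂ)) (p : Fin n → ℂ) :
    MvPolynomial (Fin n) ℂ →ₐ[ℂ] (Localization (nv n p) ⧸
      I.map (algebraMap (MvPolynomial (Fin n) ℂ) (Localization (nv n p)))) :=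
  (Ideal.Quotient.mkₐ ℂ _).comp
    (IsScalarTower.toAlgHom ℂ (MvPolynomial (Fin n) ℂ) (Localization (nv n p)))

theorem mem_ker_locq {n : ℕ} (I : Ideal (MvPolynomial (Fin n) ℂ)) (p : Fin n → ℂ)
    (x : MvPolynomial (Fin n) ℂ) :
    x ∈ RingHom.ker (locq n I p) ↔ ∃ u, eval p u ≠ 0 ∧ u * x ∈ I := by
  rw [RingHom.mem_ker]
  change Ideal.Quotient.mk _ (algebraMap _ _ x) = 0 ↔ _
  rw [Ideal.Quotient.eq_zero_iff_mem, IsLocalization.algebraMap_mem_map_algebraMap_iff (nv n p)]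
  rfl

theorem unit_mod {n : ℕ} (I : Ideal (MvPolynomial (Fin n) ℂ))
    [Module.Finite ℂ (MvPolynomial (Fin n) ℂ ⧸ I)] (p : Fin n → ℂ)
    (u : MvPolynomial (Fin n) ℂ) (hu : eval p u ≠ 0) :
    ∃ y, u * y - 1 ∈ RingHom.ker (locq n I p) := by
  set K : Ideal (MvPolynomial (Fin n) ℂ) := RingHom.ker (locq n I p) with hK
  have hle : I ≤ K := fun x hx => (mem_ker_locq I p x).mpr ⟨1, by simp, by simpa using hx⟩
  have hfin : Module.Finite ℂ (MvPolynomial (Fin n) ℂ ⧸ K) :=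
    Module.Finite.of_surjective (Ideal.Quotient.factorₐ ℂ hle).toLinearMap
      (Ideal.Quotient.factor_surjective hle)
  let T : (MvPolynomial (Fin n) ℂ ⧸ K) →ₗ[ℂ] (MvPolynomial (Fin n) ℂ ⧸ K) :=
    LinearMap.mulLeft ℂ (Ideal.Quotient.mk K u)
  have hinj : Function.Injective T := by
    rw [← LinearMap.ker_eq_bot, eq_bot_iff]
    intro x hx
    obtain ⟨q, rfl⟩ := Ideal.Quotient.mk_surjective x
    have hx' : Ideal.Quotient.mk K u * Ideal.Quotient.mk K q = 0 := hx
    rw [← map_mul, Ideal.Quotient.eq_zero_iff_mem, mem_ker_locq] at hx'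
    obtain ⟨v, hv, hvx⟩ := hx'
    rw [Submodule.mem_bot, Ideal.Quotient.eq_zero_iff_mem, mem_ker_locq]
    exact ⟨v * u, by simp [hv, hu], by rw [mul_assoc]; exact hvx⟩
  obtain ⟨y, hy⟩ := LinearMap.injective_iff_surjective.mp hinj 1
  obtain ⟨q, rfl⟩ := Ideal.Quotient.mk_surjective y
  refine ⟨q, ?_⟩
  have hy' : Ideal.Quotient.mk K u * Ideal.Quotient.mk K q = 1 := hy
  rw [← Ideal.Quotient.eq_zero_iff_mem, map_sub, map_mul, hy', map_one, sub_self]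

theorem locq_surj {n : ℕ} (I : Ideal (MvPolynomial (Fin n) ℂ))
    [Module.Finite ℂ (MvPolynomial (Fin n) ℂ ⧸ I)] (p : Fin n → ℂ) :
    Function.Surjective (locq n I p) := by
  intro z
  obtain ⟨w, rfl⟩ := Ideal.Quotient.mk_surjective z
  obtain ⟨x, u, rfl⟩ := IsLocalization.exists_mk'_eq (nv n p) w
  obtain ⟨y, hy⟩ := unit_mod I p u u.2
  rw [RingHom.mem_ker, map_sub, map_mul, map_one, sub_eq_zero] at hy
  refine ⟨x * y, ?_⟩
  have h1 : Ideal.Quotient.mk (I.map (algebraMap (MvPolynomial (Fin n) ℂ) (Localization (nv n p))))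
      (IsLocalization.mk' (Localization (nv n p)) x u) * locq n I p u = locq n I p x := by
    change Ideal.Quotient.mk _ _ * Ideal.Quotient.mk _ (algebraMap _ _ (u : MvPolynomial (Fin n) ℂ))
      = Ideal.Quotient.mk _ (algebraMap _ _ x)
    rw [← map_mul, IsLocalization.mk'_spec]
  rw [map_mul, ← h1, mul_assoc, hy]
  exact mul_one (M := Localization (nv n p) ⧸ I.map (algebraMap (MvPolynomial (Fin n) ℂ)
    (Localization (nv n p)))) _

theorem dim_count {n : ℕ} (I : Ideal (MvPolynomial (Fin n) ℂ)) (Z : Finset (Fin n → ℂ))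
    (hZ : ∀ p : Fin n → ℂ, (∀ x ∈ I, eval p x = 0) → p ∈ Z)
    [Module.Finite ℂ (MvPolynomial (Fin n) ℂ ⧸ I)] :
    Module.finrank ℂ (MvPolynomial (Fin n) ℂ ⧸ I) = ∑ p ∈ Z, locdim n I p := by
  classical
  let K : Z → Ideal (MvPolynomial (Fin n) ℂ) := fun p => RingHom.ker (locq n I p.1)
  have hle : ∀ p, I ≤ K p :=
    fun p x hx => (mem_ker_locq I p.1 x).mpr ⟨1, by simp, by simpa using hx⟩
  have hmax : ∀ M : Ideal (MvPolynomial (Fin n) ℂ), M.IsMaximal →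
      ∃ q : Fin n → ℂ, ∀ x, x ∈ M ↔ eval q x = 0 := by
    intro M hM
    obtain ⟨q, rfl⟩ := isMaximal_iff_eq_vanishingIdeal_singleton.mp hM
    exact ⟨q, fun x => by rw [mem_vanishingIdeal_singleton_iff, aeval_eq_eval]⟩
  have hinf : (⨅ p, K p) = I := by
    refine le_antisymm ?_ (le_iInf hle)
    intro x hx
    rw [Ideal.mem_iInf] at hx
    by_contra hxI
    let D : Ideal (MvPolynomial (Fin n) ℂ) := I.colon {x}
    have hD : ∀ u, u ∈ D ↔ u * x ∈ I := fun u => by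
      simp [D, Submodule.mem_colon]
    obtain ⟨M, hM, hDM⟩ := Ideal.exists_le_maximal D (fun h => hxI (by
      have : (1 : MvPolynomial (Fin n) ℂ) ∈ D := h ▸ trivial
      simpa using (hD 1).mp this))
    obtain ⟨q, hq⟩ := hmax M hM
    have hqZ : q ∈ Z := hZ q fun y hy => (hq y).mp (hDM ((hD y).mpr (I.mul_mem_right _ hy)))
    obtain ⟨u, hu, hux⟩ := (mem_ker_locq I q x).mp (hx ⟨q, hqZ⟩)
    exact hu ((hq u).mp (hDM ((hD u).mpr hux)))
  have hker : ∀ (p : Z) (r : Fin n → ℂ), (∀ x ∈ K p, eval r x = 0) → r = p.1 := by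
    intro p r hr
    by_contra hne
    obtain ⟨i, hi⟩ := Function.ne_iff.mp hne
    obtain ⟨y, hy⟩ := unit_mod I p.1 (X i - C (r i)) (by
      simpa [sub_eq_zero] using fun h => hi h.symm)
    have := hr _ hy
    simp at this
  have hcop : Pairwise (Function.onFun IsCoprime K) := by
    intro p q hpq
    change IsCoprime (K p) (K q)
    rw [Ideal.isCoprime_iff_sup_eq]
    by_contra hne
    obtain ⟨M, hM, hle'⟩ := Ideal.exists_le_maximal _ hne
    obtain ⟨r, hr⟩ := hmax M hM
    apply hpq
    apply Subtype.ext
    rw [← hker p r fun x hx => (hr x).mp (hle' (Ideal.mem_sup_left hx)),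
      ← hker q r fun x hx => (hr x).mp (hle' (Ideal.mem_sup_right hx))]
  let E1 : (MvPolynomial (Fin n) ℂ ⧸ I) ≃ₐ[ℂ] (MvPolynomial (Fin n) ℂ ⧸ ⨅ p, K p) :=
    Ideal.quotientEquivAlgOfEq ℂ hinf.symm
  let E2 : (MvPolynomial (Fin n) ℂ ⧸ ⨅ p, K p) ≃ₐ[ℂ] (∀ p, MvPolynomial (Fin n) ℂ ⧸ K p) :=
    AlgEquiv.ofRingEquiv (f := Ideal.quotientInfRingEquivPiQuotient K hcop) (fun c => rfl)
  let E3 : ∀ p : Z, (MvPolynomial (Fin n) ℂ ⧸ K p) ≃ₐ[ℂ] (Localization (nv n p.1) ⧸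
      I.map (algebraMap (MvPolynomial (Fin n) ℂ) (Localization (nv n p.1)))) :=
    fun p => Ideal.quotientKerAlgEquivOfSurjective (locq_surj I p.1)
  have hfin : ∀ p : Z, Module.Finite ℂ (MvPolynomial (Fin n) ℂ ⧸ K p) := fun p =>
    Module.Finite.of_surjective (Ideal.Quotient.factorₐ ℂ (hle p)).toLinearMap
      (Ideal.Quotient.factor_surjective (hle p))
  rw [(E1.trans E2).toLinearEquiv.finrank_eq, Module.finrank_pi_fintype, ← Finset.sum_coe_sort Z]
  exact Finset.sum_congr rfl fun p _ => (E3 p).toLinearEquiv.finrank_eq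

theorem locdim_congr {n : ℕ} (I J : Ideal (MvPolynomial (Fin n) ℂ)) (p : Fin n → ℂ)
    (h : I.map (algebraMap (MvPolynomial (Fin n) ℂ) (Localization (nv n p))) =
      J.map (algebraMap (MvPolynomial (Fin n) ℂ) (Localization (nv n p)))) :
    locdim n I p = locdim n J p := by
  unfold locdim
  rw [h]

theorem deh_eval {n : ℕ} (q : MvPolynomial (Fin (n + 1)) ℂ) (p : Fin n → ℂ) :
    eval p (deh n q) = eval (Fin.cons 1 p : Fin (n + 1) → ℂ) q := by
  induction q using MvPolynomial.induction_on with
  | C a => simp [deh]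
  | add a b ha hb => simp [ha, hb]
  | mul_X a i ha =>
    rw [map_mul, map_mul, ha, map_mul]
    congr 1
    refine Fin.cases ?_ (fun j => ?_) i <;> simp [deh]

theorem deh_pderiv {n : ℕ} (q : MvPolynomial (Fin (n + 1)) ℂ) (j : Fin n) :
    pderiv j (deh n q) = deh n (pderiv j.succ q) := by
  induction q using MvPolynomial.induction_on with
  | C a => simp [deh]
  | add a b ha hb => simp [ha, hb]
  | mul_X a i ha =>
    rw [map_mul, Derivation.leibniz, Derivation.leibniz, ha]
    refine Fin.cases ?_ (fun k => ?_) i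
    · simp [deh, pderiv_X]
    · by_cases hk : j = k
      · subst hk
        simp [deh, pderiv_X]
      · simp [deh, pderiv_X, Pi.single_apply, hk, Ne.symm hk, eq_comm]

theorem eval_smul_homog {m k : ℕ} (q : MvPolynomial (Fin m) ℂ) (hq : q.IsHomogeneous k) (a : ℂ)
    (v : Fin m → ℂ) : eval (a • v) q = a ^ k * eval v q := by
  rw [eval_eq', eval_eq', Finset.mul_sum]
  refine Finset.sum_congr rfl fun s hs => ?_
  have hd : ∑ i, s i = k := by
    rw [← Finsupp.degree_eq_sum]
    by_contra hne
    exact (mem_support_iff.mp hs) (hq.coeff_eq_zero hne)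
  simp only [Pi.smul_apply, smul_eq_mul, mul_pow, Finset.prod_mul_distrib,
    Finset.prod_pow_eq_pow_sum, hd]
  ring

theorem sing_finite (n d : ℕ) (f : MvPolynomial (Fin (n + 1)) ℂ)
    (hf : f.IsHomogeneous d)
    (hiso : {P : Projectivization ℂ (Fin (n + 1) → ℂ) |
      ∀ i, eval P.rep (pderiv i f) = 0}.Finite) :
    {p : Fin n → ℂ | eval p (deh n f) = 0 ∧
        ∀ j, eval p (pderiv j (deh n f)) = 0}.Finite := by
  have hne : ∀ p : Fin n → ℂ, (Fin.cons 1 p : Fin (n + 1) → ℂ) ≠ 0 := fun p h => by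
    have := congrFun h 0
    simp at this
  let φ : (Fin n → ℂ) → Projectivization ℂ (Fin (n + 1) → ℂ) :=
    fun p => Projectivization.mk ℂ (Fin.cons 1 p) (hne p)
  have hinj : Function.Injective φ := by
    intro p q hpq
    obtain ⟨a, ha⟩ := (Projectivization.mk_eq_mk_iff' ℂ _ _ _ _).mp hpq
    have h0 := congrFun ha 0
    simp at h0
    subst h0
    ext j
    have := congrFun ha j.succ
    simpa using this.symm
  refine Set.Finite.subset (hiso.preimage hinj.injOn) ?_
  rintro p ⟨hp1, hp2⟩ i
  obtain ⟨a, ha⟩ := Projectivization.exists_smul_eq_mk_rep ℂ (Fin.cons 1 p : Fin (n + 1) → ℂ) (hne p)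
  change eval (φ p).rep (pderiv i f) = 0
  have hrep : (φ p).rep = (a : ℂ) • (Fin.cons 1 p : Fin (n + 1) → ℂ) := ha.symm
  have hall : ∀ i, eval (Fin.cons 1 p : Fin (n + 1) → ℂ) (pderiv i f) = 0 := by
    have hs : ∀ j : Fin n, eval (Fin.cons 1 p : Fin (n + 1) → ℂ) (pderiv j.succ f) = 0 := by
      intro j
      rw [← deh_eval, ← deh_pderiv]
      exact hp2 j
    have he := congrArg (eval (Fin.cons 1 p : Fin (n + 1) → ℂ)) hf.sum_X_mul_pderiv
    rw [deh_eval] at hp1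
    rw [map_sum, Fin.sum_univ_succ] at he
    simp [hs, hp1] at he
    intro i
    refine Fin.cases he hs i
  have hh : (pderiv i f).IsHomogeneous (d - 1) := hf.pderiv
  rw [hrep]
  rw [eval_smul_homog _ hh, hall i, mul_zero]

/-- The Milnor-number part of Proposition 3.5 (via Briançon–Skoda): if `V(f) ⊆ ℙⁿ` has only
isolated singularities, none of them on `x₀ = 0`, and `g = f(1,y)`, then `ℂ[y]/(gⁿ,g₁,…,gₙ)`
is a finite-dimensional `ℂ`-vector space whose dimension is the (finite) sum over the common
zeros `p` of `g, g₁, …, gₙ` of the local dimensions `dim_ℂ (ℂ[y]/(g₁,…,gₙ))_{𝔪_p}`, i.e. it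
equals the total Milnor number `μ(V)`. -/
theorem stmt_10 (n d : ℕ) (hn : 2 ≤ n) (f : MvPolynomial (Fin (n + 1)) ℂ)
    (hf : f.IsHomogeneous d)
    (hiso : {P : Projectivization ℂ (Fin (n + 1) → ℂ) |
      ∀ i, eval P.rep (pderiv i f) = 0}.Finite)
    (hx0 : ∀ q : Fin (n + 1) → ℂ, q ≠ 0 →
      (∀ i, eval q (pderiv i f) = 0) → q 0 ≠ 0) :
    ∃ hZ : {p : Fin n → ℂ | eval p (deh n f) = 0 ∧
        ∀ j, eval p (pderiv j (deh n f)) = 0}.Finite,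
      FiniteDimensional ℂ (MvPolynomial (Fin n) ℂ ⧸
        Ideal.span ({(deh n f) ^ n} ∪ Set.range fun j : Fin n => pderiv j (deh n f))) ∧
      Module.finrank ℂ (MvPolynomial (Fin n) ℂ ⧸
        Ideal.span ({(deh n f) ^ n} ∪ Set.range fun j : Fin n => pderiv j (deh n f))) =
        ∑ p ∈ hZ.toFinset,
          locdim n (Ideal.span (Set.range fun j : Fin n => pderiv j (deh n f))) p := by
  set g := deh n f with hg
  have hZ := sing_finite n d f hf hiso
  have hn0 : n ≠ 0 := by omega
  have hmem : ∀ p : Fin n → ℂ, (∀ x ∈ Ideal.span ({g ^ n} ∪ Set.range fun j : Fin n => pderiv j g),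
      eval p x = 0) → p ∈ hZ.toFinset := by
    intro p hp
    rw [Set.Finite.mem_toFinset]
    refine ⟨?_, fun j => hp _ (Ideal.subset_span (Or.inr ⟨j, rfl⟩))⟩
    have := hp _ (Ideal.subset_span (Or.inl rfl))
    rw [map_pow] at this
    exact (pow_eq_zero_iff hn0).mp this
  have hfin := finite_quot _ hZ.toFinset hmem
  refine ⟨hZ, hfin, ?_⟩
  rw [dim_count _ hZ.toFinset hmem]
  refine Finset.sum_congr rfl fun p hp => ?_
  rw [Set.Finite.mem_toFinset] at hp
  apply locdim_congr
  apply le_antisymm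
  · rw [Ideal.map_le_iff_le_comap, Ideal.span_le]
    rintro x (rfl | hx)
    · obtain ⟨u, hu, hux⟩ := bs_local (by omega) g p hp.1
      exact (IsLocalization.algebraMap_mem_map_algebraMap_iff (nv n p) _ _ _).mpr ⟨u, hu, hux⟩
    · exact Ideal.mem_map_of_mem _ (Ideal.subset_span hx)
  · exact Ideal.map_mono (Ideal.span_mono Set.subset_union_right)
end
end

section
/- Let f ∈ ℂ[x₀,x₁,x₂] be homogeneous of degree d with C = V(f) ⊆ ℙ² a singular reduced curve with only isolated singularities, not a cone (the three partials ∂₀f, ∂₁f, ∂₂f are ℂ-linearly independent). Let ρ₁,…,ρ_m, with ρⱼ = (A₀ʲ, A₁ʲ, A₂ʲ), be a minimal system of homogeneous generators of Syz(J_f), let M_f be the 3×m matrix with columns ρⱼ, let P_f be an m×(m−2) matrix over R whose columns generate the R-module { h ∈ R^m : M_f·h = 0 } (so that 0 → R^{m−2} → R^m → R³ → J_f(d−1) → 0 is a minimal free resolution), and let N be any m×3 matrix over R with M_f·N = K, the skew-symmetric Koszul matrix. In B = ℂ[x₀,x₁,x₂,y₀,y₁,y₂] set Fⱼ = A₀ʲy₀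 + A₁ʲy₁ + A₂ʲy₂ for j = 1,…,m. Then the B-module of syzygies { (h₁,…,h_m) ∈ B^m : h₁F₁ + ⋯ + h_mF_m = 0 } is generated by the m−2 columns of P_f (viewed in B^m) together with the column vector N·(y₀,y₁,y₂)ᵗ ∈ B^m. -/
open MvPolynomial

noncomputable section

/-- The skew-symmetric Koszul matrix of `f ∈ ℂ[x₀,x₁,x₂]`. -/
def koszulMat (f : MvPolynomial (Fin 3) ℂ) : Matrix (Fin 3) (Fin 3) (MvPolynomial (Fin 3) ℂ) :=
  !![0, pderiv 2 f, -(pderiv 1 f);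
     -(pderiv 2 f), 0, pderiv 0 f;
     pderiv 1 f, -(pderiv 0 f), 0]

theorem aux_pderiv_zero (p : MvPolynomial (Fin 3) ℂ) (i : Fin 3) (h : p ∣ pderiv i p) :
    pderiv i p = 0 := by
  by_contra hne
  obtain ⟨q, hq⟩ := h
  have hp : p ≠ 0 := by rintro rfl; simp at hne
  have hq0 : q ≠ 0 := by rintro rfl; simp at hq; exact hne hq
  have h1 : degreeOf i p ≤ degreeOf i (pderiv i p) := by
    rw [hq, degreeOf_mul_eq hp hq0]; omega
  have h3 : ∀ s ∈ (pderiv i p).support, s i + 1 ≤ degreeOf i p := by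
    intro s hs
    rw [mem_support_iff, coeff_pderiv] at hs
    have := left_ne_zero_of_mul hs
    have h4 := monomial_le_degreeOf i (mem_support_iff.mpr this)
    simpa using h4
  obtain ⟨s, hs⟩ := support_nonempty.mpr hne
  have h5 : 0 < degreeOf i p := by have := h3 s hs; omega
  have h2 : degreeOf i (pderiv i p) < degreeOf i p := by
    rw [degreeOf_lt_iff h5]
    intro s hs
    have := h3 s hs
    omega
  omega

theorem aux_const (p : MvPolynomial (Fin 3) ℂ) (h : ∀ i, pderiv i p = 0) :
    p = C (coeff 0 p) := by
  ext n
  rw [coeff_C]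
  split_ifs with hn
  · rw [hn]
  · have : ∃ i, n i ≠ 0 := by
      by_contra hc
      push Not at hc
      exact hn (by ext i; simp [hc i])
    obtain ⟨i, hi⟩ := this
    have h1 := coeff_pderiv (i := i) p (n - Finsupp.single i 1)
    have h2 : n - Finsupp.single i 1 + Finsupp.single i 1 = n := by
      apply tsub_add_cancel_of_le
      rw [Finsupp.single_le_iff]
      omega
    rw [h i, h2, coeff_zero] at h1
    rcases mul_eq_zero.mp h1.symm with h3 | h3
    · exact h3
    · exfalso
      exact Nat.cast_add_one_ne_zero _ h3

theorem aux_coprime (d : ℕ) (f : MvPolynomial (Fin 3) ℂ) (hf : f.IsHomogeneous d)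
    (hred : Squarefree f) (h0 : pderiv 0 f ≠ 0) (p : MvPolynomial (Fin 3) ℂ) (hp : Prime p)
    (h : ∀ i, p ∣ pderiv i f) : False := by
  have hd : d ≠ 0 := by
    rintro rfl
    have := totalDegree_eq_zero_iff_eq_C.mp (Nat.le_zero.mp hf.totalDegree_le)
    rw [this] at h0
    simp at h0
  have he := hf.sum_X_mul_pderiv
  have h1 : p ∣ f := by
    have h2 : p ∣ d • f := by
      rw [← he]
      exact Finset.dvd_sum fun i _ => (h i).mul_left _
    have h3 : f = C ((d : ℂ)⁻¹) * (d • f) := by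
      rw [nsmul_eq_mul, ← mul_assoc, ← map_natCast (C : ℂ →+* MvPolynomial (Fin 3) ℂ), ← C_mul,
        inv_mul_cancel₀ (by exact_mod_cast hd), C_1, one_mul]
    rw [h3]
    exact h2.mul_left _
  obtain ⟨q, rfl⟩ := h1
  have hq : ¬ p ∣ q := by
    rintro ⟨r, rfl⟩
    exact hp.not_isUnit (hred p ⟨r, by ring⟩)
  have h4 : ∀ i, pderiv i p = 0 := by
    intro i
    apply aux_pderiv_zero
    have h5 := h i
    rw [pderiv_mul] at h5
    have h6 : p ∣ pderiv i p * q := (dvd_add_left (dvd_mul_right p _)).mp h5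
    exact (hp.dvd_or_dvd h6).resolve_right hq
  have h7 := aux_const p h4
  apply hp.not_isUnit
  rw [h7]
  apply IsUnit.map
  rw [isUnit_iff_ne_zero]
  intro h8
  rw [h8, C_0] at h7
  exact hp.ne_zero h7

theorem aux_field {K : Type*} [Field K] (r1 r2 : K) (v1 v2 : MvPolynomial (Fin 3) K)
    (h : v1 * (X 1 - C r1 * X 0) + v2 * (X 2 - C r2 * X 0) = 0) :
    ∃ b, v1 = -(X 2 - C r2 * X 0) * b ∧ v2 = (X 1 - C r1 * X 0) * b := by
  let φ : MvPolynomial (Fin 3) K →ₐ[K] MvPolynomial (Fin 3) K :=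
    aeval ![X 0, X 1 + C r1 * X 0, X 2 + C r2 * X 0]
  let ψ : MvPolynomial (Fin 3) K →ₐ[K] MvPolynomial (Fin 3) K :=
    aeval ![X 0, X 1 - C r1 * X 0, X 2 - C r2 * X 0]
  have hψφ : ∀ p, ψ (φ p) = p := by
    intro p
    have : ψ.comp φ = AlgHom.id K _ := by
      ext i
      fin_cases i <;> simp [φ, ψ, ← algebraMap_eq]
    exact congrArg (fun g => g p) this
  have h1 : φ v1 * X 1 + φ v2 * X 2 = 0 := by
    have := congrArg φ h
    simpa [φ, ← algebraMap_eq] using this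
  have h2 : (X 1 : MvPolynomial (Fin 3) K) ∣ φ v2 * X 2 := ⟨-φ v1, by linear_combination h1⟩
  rw [X_dvd_mul_iff] at h2
  have h3 : ¬ (X 1 : MvPolynomial (Fin 3) K) ∣ X 2 := by
    rw [X_dvd_X]; simp
  obtain ⟨b, hb⟩ := h2.resolve_right h3
  have h4 : φ v1 = - X 2 * b := by
    have : (X 1 : MvPolynomial (Fin 3) K) * (φ v1 + X 2 * b) = 0 := by
      rw [hb] at h1; linear_combination h1
    have := (mul_eq_zero.mp this).resolve_left (X_ne_zero _)
    linear_combination this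
  refine ⟨ψ b, ?_, ?_⟩
  · rw [← hψφ v1, h4]; simp [ψ]; ring
  · rw [← hψφ v2, hb]; simp [ψ]

theorem aux_ufd {R : Type*} [CommRing R] [IsDomain R] [UniqueFactorizationMonoid R]
    (g : Fin 3 → R) (hg0 : g 0 ≠ 0) (hg : ∀ p, Prime p → (∀ i, p ∣ g i) → False)
    (t v : Fin 3 → MvPolynomial (Fin 3) R)
    (ht : t = ![C (g 1) * X 2 - C (g 2) * X 1, C (g 2) * X 0 - C (g 0) * X 2,
      C (g 0) * X 1 - C (g 1) * X 0]) (c : R) (hc : c ≠ 0) :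
    ∀ a, (∀ i, C c * v i = a * t i) → ∃ a', ∀ i, v i = a' * t i := by
  induction c using UniqueFactorizationMonoid.induction_on_prime with
  | h₁ => exact absurd rfl hc
  | h₂ x hx =>
    intro a ha
    obtain ⟨u, rfl⟩ := hx
    refine ⟨C (↑u⁻¹ : R) * a, fun i => ?_⟩
    rw [mul_assoc, ← ha i, ← mul_assoc, ← C_mul]
    simp
  | h₃ c p hc' hp ih =>
    intro a ha
    have hcp : Prime (C p : MvPolynomial (Fin 3) R) := (MvPolynomial.prime_C_iff (Fin 3)).mpr hp
    have h1 : C p ∣ a := by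
      by_contra hna
      have h2 : ∀ i, C p ∣ t i := fun i =>
        (hcp.dvd_or_dvd (⟨C c * v i, by rw [← ha i, C_mul]; ring⟩ : C p ∣ a * t i)).resolve_left hna
      have k0 := (C_dvd_iff_dvd_coeff _ _).mp (h2 0)
      have k1 := (C_dvd_iff_dvd_coeff _ _).mp (h2 1)
      apply hg p hp
      have e0 := k1 (Finsupp.single 2 1)
      have e1 := k0 (Finsupp.single 2 1)
      have e2 := k0 (Finsupp.single 1 1)
      simp [ht, coeff_C_mul, coeff_X, Finsupp.single_left_inj] at e0 e1 e2
      intro i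
      fin_cases i
      · exact e0
      · exact e1
      · exact e2
    obtain ⟨a', rfl⟩ := h1
    refine ih hc' a' fun i => ?_
    apply mul_left_cancel₀ hcp.ne_zero
    rw [← mul_assoc, ← C_mul, ha i]; ring

theorem aux_cross {R : Type*} [CommRing R] [IsDomain R] [UniqueFactorizationMonoid R]
    (g : Fin 3 → R) (hg0 : g 0 ≠ 0) (hg : ∀ p, Prime p → (∀ i, p ∣ g i) → False)
    (v : Fin 3 → MvPolynomial (Fin 3) R)
    (hv : ∑ i, v i * C (g i) = 0) (hy : ∑ i, v i * X i = 0) :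
    ∃ a, ∀ i, v i = a * (![C (g 1) * X 2 - C (g 2) * X 1, C (g 2) * X 0 - C (g 0) * X 2,
      C (g 0) * X 1 - C (g 1) * X 0] : Fin 3 → MvPolynomial (Fin 3) R) i := by
  let K := FractionRing R
  let ι : MvPolynomial (Fin 3) R →+* MvPolynomial (Fin 3) K := map (algebraMap R K)
  have hι : Function.Injective ι := map_injective _ (IsFractionRing.injective R K)
  let G : Fin 3 → K := fun i => algebraMap R K (g i)
  have hG : G 0 ≠ 0 := by simpa [G] using hg0
  have hGG : (C (G 0)⁻¹ : MvPolynomial (Fin 3) K) * C (G 0) = 1 := by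
    rw [← C_mul, inv_mul_cancel₀ hG, C_1]
  rw [Fin.sum_univ_three] at hv hy
  have hv' : ι (v 0) * C (G 0) + ι (v 1) * C (G 1) + ι (v 2) * C (G 2) = 0 := by
    have := congrArg ι hv
    simpa [ι, G] using this
  have hy' : ι (v 0) * X 0 + ι (v 1) * X 1 + ι (v 2) * X 2 = 0 := by
    have := congrArg ι hy
    simpa [ι, G] using this
  obtain ⟨b, hb1, hb2⟩ := aux_field ((G 0)⁻¹ * G 1) ((G 0)⁻¹ * G 2) (ι (v 1)) (ι (v 2)) (by
    simp only [C_mul]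
    linear_combination hy' - C (G 0)⁻¹ * X 0 * hv' + ι (v 0) * X 0 * hGG)
  have hb0 : ι (v 0) = C (G 0)⁻¹ * (C (G 1) * X 2 - C (G 2) * X 1) * b := by
    rw [hb1, hb2] at hv'
    simp only [C_mul] at hv'
    linear_combination C (G 0)⁻¹ * hv' - ι (v 0) * hGG
  letI : Algebra (MvPolynomial (Fin 3) R) (MvPolynomial (Fin 3) K) := algebraMvPolynomial
  obtain ⟨⟨a, s⟩, hs⟩ := IsLocalization.surj ((nonZeroDivisors R).map (C (σ := Fin 3)))
    (b * C (G 0)⁻¹ : MvPolynomial (Fin 3) K)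
  obtain ⟨s, c, hc, rfl⟩ := s
  have hc' : ι (C c) = C (algebraMap R K c) := by simp [ι]
  have hs' : b * C (G 0)⁻¹ * C (algebraMap R K c) = ι a := by
    have hs2 : b * C (G 0)⁻¹ * ι (C c) = ι a := hs
    rwa [hc'] at hs2
  refine aux_ufd g hg0 hg _ v rfl c (nonZeroDivisors.ne_zero hc) a ?_
  intro i
  apply hι
  rw [map_mul, map_mul, ← hs']
  rw [hc']
  have hgi : ∀ i, ι (C (g i)) = C (G i) := fun i => by simp [ι, G]
  have hXi : ∀ i, ι (X i) = X i := fun i => by simp [ι]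
  fin_cases i
  · change C (algebraMap R K c) * ι (v 0) = _ * ι (C (g 1) * X 2 - C (g 2) * X 1)
    rw [hb0]
    simp only [map_sub, map_mul, hgi, hXi]
    ring
  · change C (algebraMap R K c) * ι (v 1) = _ * ι (C (g 2) * X 0 - C (g 0) * X 2)
    rw [hb1]
    simp only [map_sub, map_mul, hgi, hXi]
    linear_combination C (algebraMap R K c) * b * X 2 * hGG
  · change C (algebraMap R K c) * ι (v 2) = _ * ι (C (g 0) * X 1 - C (g 1) * X 0)
    rw [hb2]
    simp only [map_sub, map_mul, hgi, hXi]
    linear_combination -C (algebraMap R K c) * b * X 1 * hGG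

theorem aux_ker {R : Type*} [CommRing R] {m k : ℕ} (ρ : Fin m → Fin 3 → R)
    (P : Matrix (Fin m) (Fin k) R)
    (hPgen : ∀ h : Fin m → R, (∀ i, ∑ j, ρ j i * h j = 0) →
        h ∈ Submodule.span R (Set.range fun c : Fin k => fun j => P j c))
    (h : Fin m → MvPolynomial (Fin 3) R) (hh : ∀ i, ∑ j, C (ρ j i) * h j = 0) :
    h ∈ Submodule.span (MvPolynomial (Fin 3) R)
      (Set.range fun c : Fin k => fun j => (C (P j c) : MvPolynomial (Fin 3) R)) := by
  classical
  let S := Finset.univ.biUnion fun j => (h j).support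
  have h1 : h = ∑ s ∈ S, (monomial s (1 : R)) • (fun j => C (coeff s (h j))) := by
    funext j
    rw [Finset.sum_apply]
    conv_lhs => rw [(h j).as_sum]
    rw [Finset.sum_subset (Finset.subset_biUnion_of_mem (fun j => (h j).support)
      (Finset.mem_univ j))]
    · refine Finset.sum_congr rfl fun s _ => ?_
      simp [mul_comm, C_mul_monomial]
    · intro s _ hs
      rw [notMem_support_iff.mp hs, monomial_zero]
  rw [h1]
  refine Submodule.sum_mem _ fun s _ => Submodule.smul_mem _ _ ?_
  have h2 := hPgen (fun j => coeff s (h j)) (fun i => by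
    have := congrArg (coeff s) (hh i)
    simpa [coeff_sum, coeff_C_mul] using this)
  rw [Submodule.mem_span_range_iff_exists_fun] at h2 ⊢
  obtain ⟨c, hc⟩ := h2
  refine ⟨fun i => C (c i), ?_⟩
  funext j
  have := congrArg (C (σ := Fin 3)) (congrFun hc j)
  simpa [Finset.sum_apply] using this

/-- Proposition 4.4: let `C = V(f) ⊆ ℙ²` be a singular reduced curve with only isolated
singularities, not a cone, `ρ₁,…,ρ_m` a minimal system of homogeneous generators of
`Syz(J_f)` (columns of `M_f`), `P_f` an `m×(m−2)` matrix whose columns generate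
`{h : M_f·h = 0}`, and `N` an `m×3` matrix with `M_f·N = K` (Koszul matrix). In
`B = ℂ[x₀,x₁,x₂,y₀,y₁,y₂]` set `Fⱼ = A₀ʲy₀ + A₁ʲy₁ + A₂ʲy₂`. Then the `B`-module of
syzygies of `F₁,…,F_m` is generated by the columns of `P_f` together with `N·(y₀,y₁,y₂)ᵗ`. -/
theorem stmt_15 (d m : ℕ) (f : MvPolynomial (Fin 3) ℂ)
    (hf : f.IsHomogeneous d) (hred : Squarefree f)
    (hsing : ∃ q : Fin 3 → ℂ, q ≠ 0 ∧ ∀ i, eval q (pderiv i f) = 0)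
    (hiso : {P : Projectivization ℂ (Fin 3 → ℂ) |
      ∀ i, eval P.rep (pderiv i f) = 0}.Finite)
    (hnc : LinearIndependent ℂ ![pderiv 0 f, pderiv 1 f, pderiv 2 f])
    (ρ : Fin m → Fin 3 → MvPolynomial (Fin 3) ℂ)
    (dd : Fin m → ℕ) (hhom : ∀ j i, (ρ j i).IsHomogeneous (dd j))
    (hsyz : ∀ j, ∑ i, ρ j i * pderiv i f = 0)
    (hgen : ∀ A : Fin 3 → MvPolynomial (Fin 3) ℂ,
      (∑ i, A i * pderiv i f = 0) →
        A ∈ Submodule.span (MvPolynomial (Fin 3) ℂ) (Set.range ρ))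
    (hmin : ∀ j, ρ j ∉ Submodule.span (MvPolynomial (Fin 3) ℂ) (ρ '' {j' | j' ≠ j}))
    (P : Matrix (Fin m) (Fin (m - 2)) (MvPolynomial (Fin 3) ℂ))
    (hPsyz : ∀ c i, ∑ j, ρ j i * P j c = 0)
    (hPgen : ∀ h : Fin m → MvPolynomial (Fin 3) ℂ,
      (∀ i, ∑ j, ρ j i * h j = 0) →
        h ∈ Submodule.span (MvPolynomial (Fin 3) ℂ)
          (Set.range fun c : Fin (m - 2) => fun j => P j c))
    (N : Matrix (Fin m) (Fin 3) (MvPolynomial (Fin 3) ℂ))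
    (hN : (Matrix.of fun i j => ρ j i) * N = koszulMat f) :
    ∀ h : Fin m → MvPolynomial (Fin 3) (MvPolynomial (Fin 3) ℂ),
      (∑ j, h j * (∑ i, C (ρ j i) * X i) = 0) ↔
        h ∈ Submodule.span (MvPolynomial (Fin 3) (MvPolynomial (Fin 3) ℂ))
          ((Set.range fun c : Fin (m - 2) =>
              fun j => (C (P j c) : MvPolynomial (Fin 3) (MvPolynomial (Fin 3) ℂ))) ∪
            {fun j => ∑ i, C (N j i) * X i}) := by
  have hnz : pderiv 0 f ≠ 0 := by simpa using hnc.ne_zero 0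
  have hcop := aux_coprime d f hf hred hnz
  -- rows of `M N y`
  have hNy : ∀ i, ∑ j, C (ρ j i) * (∑ k, C (N j k) * X k) =
      -(![C (pderiv 1 f) * X 2 - C (pderiv 2 f) * X 1, C (pderiv 2 f) * X 0 - C (pderiv 0 f) * X 2,
      C (pderiv 0 f) * X 1 - C (pderiv 1 f) * X 0] :
        Fin 3 → MvPolynomial (Fin 3) (MvPolynomial (Fin 3) ℂ)) i := by
    intro i
    have h1 : ∑ j, C (ρ j i) * (∑ k, C (N j k) * X k) =
        ∑ k, C (koszulMat f i k) * (X k : MvPolynomial (Fin 3) (MvPolynomial (Fin 3) ℂ)) := by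
      rw [← hN]
      simp only [Matrix.mul_apply, Matrix.of_apply, map_sum, map_mul, Finset.mul_sum,
        Finset.sum_mul]
      rw [Finset.sum_comm]
      simp only [mul_assoc]
    rw [h1, Fin.sum_univ_three]
    fin_cases i <;> simp [koszulMat] <;> ring
  have hswap : ∀ h : Fin m → MvPolynomial (Fin 3) (MvPolynomial (Fin 3) ℂ),
      ∑ j, h j * (∑ i, C (ρ j i) * X i) = ∑ i, (∑ j, C (ρ j i) * h j) * X i := by
    intro h
    simp only [Finset.mul_sum, Finset.sum_mul]
    rw [Finset.sum_comm]
    refine Finset.sum_congr rfl fun i _ => Finset.sum_congr rfl fun j _ => by ring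
  intro h
  constructor
  · intro hh
    rw [hswap] at hh
    have hv : ∑ i, (∑ j, C (ρ j i) * h j) * C (pderiv i f) = 0 := by
      simp only [Finset.sum_mul]
      rw [Finset.sum_comm]
      refine Finset.sum_eq_zero fun j _ => ?_
      have := congrArg (fun z => h j * C z) (hsyz j)
      simp only [map_sum, map_mul, map_zero, mul_zero, Finset.mul_sum] at this
      rw [← this]
      refine Finset.sum_congr rfl fun i _ => by ring
    obtain ⟨a, ha⟩ := aux_cross (fun i => pderiv i f) hnz hcop _ hv hh
    have hk := aux_ker ρ P hPgen (fun j => h j + a * ∑ k, C (N j k) * X k) (by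
      intro i
      have h1 : ∑ j, C (ρ j i) * (h j + a * ∑ k, C (N j k) * X k) =
          ∑ j, C (ρ j i) * h j + a * ∑ j, C (ρ j i) * (∑ k, C (N j k) * X k) := by
        rw [Finset.mul_sum, ← Finset.sum_add_distrib]
        refine Finset.sum_congr rfl fun j _ => by ring
      rw [h1, hNy, ha i]
      ring)
    have h2 : h = (fun j => h j + a * ∑ k, C (N j k) * X k) -
        a • (fun j => ∑ k, C (N j k) * X k) := by
      funext j; simp
    rw [h2]
    refine Submodule.sub_mem _ (Submodule.span_mono Set.subset_union_left hk)
      (Submodule.smul_mem _ _ (Submodule.subset_span (Or.inr rfl)))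
  · intro hh
    induction hh using Submodule.span_induction with
    | mem x hx =>
      rw [hswap]
      rcases hx with ⟨c, rfl⟩ | hx
      · refine Finset.sum_eq_zero fun i _ => ?_
        have := congrArg (C : _ →+* MvPolynomial (Fin 3) (MvPolynomial (Fin 3) ℂ)) (hPsyz c i)
        simp only [map_sum, map_mul, map_zero] at this
        simp only [this, zero_mul]
      · rw [Set.mem_singleton_iff] at hx
        subst hx
        rw [Finset.sum_congr rfl fun i _ => by rw [hNy i], Fin.sum_univ_three]
        simp
        ring
    | zero => simp
    | add x y _ _ hx hy =>
      simp only [Pi.add_apply, add_mul, Finset.sum_add_distrib, hx, hy, add_zero]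
    | smul a x _ hx =>
      simp only [Pi.smul_apply, smul_eq_mul, mul_assoc, ← Finset.mul_sum, hx, mul_zero]
end
end
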